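/- Let n ≥ 2, s ∈ (0,1), α > 0, and let μ_{n,s} > 0 be defined by μ_{n,s}^{−1} = inf{ P(E)^s / (s(1−s) P_s(E)) : |E| = 1 }. Suppose there exists a sequence m_k → ∞ such that for each k there is a bounded global minimizer E_k of F_{s,α} under the constraint |E| = m_k. Then the rescaled sets F_k = m_k^{−1/n} E_k satisfy |F_k| = 1, form a minimizing sequence for μ_{n,s}^{−1}, i.e. P(F_k)^s / (s(1−s) P_s(F_k)) → μ_{n,s}^{−1}, and there exists C > 0 such that P(F_k) ≥ C·m_k^{1/n} → ∞ as k → ∞. -/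

import Mathlib

open MeasureTheory Metric Set Filter
open scoped ENNReal Pointwise symmDiff Classical

noncomputable section

abbrev Euc (n : ℕ) := EuclideanSpace ℝ (Fin n)

/-- Divergence of a vector field on ℝⁿ. -/
def divg {n : ℕ} (g : Euc n → Euc n) (x : Euc n) : ℝ :=
  ∑ i : Fin n, fderiv ℝ g x (EuclideanSpace.single i 1) i

/-- The admissible values in the variational definition of the perimeter:
values `∫_E div g` over C¹ compactly supported vector fields with `‖g‖ ≤ 1`. -/
def perimVals {n : ℕ} (E : Set (Euc n)) : Set ℝ :=
  {r | ∃ g : Euc n → Euc n, ContDiff ℝ 1 g ∧ HasCompactSupport g ∧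
        (∀ x, ‖g x‖ ≤ 1) ∧ r = ∫ x in E, divg g x}

/-- Perimeter: total variation of the characteristic function. -/
def perim {n : ℕ} (E : Set (Euc n)) : ℝ := sSup (perimVals E)

/-- A set has finite perimeter if the variational quantities are bounded above. -/
def HasFinitePerim {n : ℕ} (E : Set (Euc n)) : Prop := BddAbove (perimVals E)

/-- Characteristic function of a set. -/
def chi {n : ℕ} (E : Set (Euc n)) : Euc n → ℝ := E.indicator 1

/-- Nonlocal perimeter associated with a kernel `K`. -/
def PK {n : ℕ} (K : Euc n → ℝ) (E : Set (Euc n)) : ℝ :=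
  ∫ x, ∫ y, K (x - y) * |chi E x - chi E y|

/-- Fractional `s`-perimeter. -/
def Ps (n : ℕ) (s : ℝ) (E : Set (Euc n)) : ℝ :=
  ∫ x : Euc n, ∫ y : Euc n, |chi E x - chi E y| / ‖x - y‖ ^ ((n : ℝ) + s)

/-- The energy `J_α(E) = P(E) - α s (1-s) P_K(E)`. -/
def Jen {n : ℕ} (K : Euc n → ℝ) (s α : ℝ) (E : Set (Euc n)) : ℝ :=
  perim E - α * s * (1 - s) * PK K E

/-- The energy `F_{s,α}(E) = P(E) - α s (1-s) P_s(E)`. -/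
def Fen (n : ℕ) (s α : ℝ) (E : Set (Euc n)) : ℝ :=
  perim E - α * s * (1 - s) * Ps n s E

/-- ω_n : volume of the unit ball of ℝⁿ. -/
def ballVol (n : ℕ) : ℝ := (volume (ball (0 : Euc n) 1)).toReal

/-- Volume-constrained global minimizer of `J_α` (volume `m`). -/
def IsJMin {n : ℕ} (K : Euc n → ℝ) (s α m : ℝ) (E : Set (Euc n)) : Prop :=
  MeasurableSet E ∧ HasFinitePerim E ∧ volume E = ENNReal.ofReal m ∧
    ∀ F : Set (Euc n), MeasurableSet F → HasFinitePerim F →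
      volume F = ENNReal.ofReal m → Jen K s α E ≤ Jen K s α F

/-- Volume-constrained global minimizer of `F_{s,α}` (volume `m`). -/
def IsFMin (n : ℕ) (s α m : ℝ) (E : Set (Euc n)) : Prop :=
  MeasurableSet E ∧ HasFinitePerim E ∧ volume E = ENNReal.ofReal m ∧
    ∀ F : Set (Euc n), MeasurableSet F → HasFinitePerim F →
      volume F = ENNReal.ofReal m → Fen n s α E ≤ Fen n s α F

lemma zero_mem_perimVals {n : ℕ} (E : Set (Euc n)) : (0 : ℝ) ∈ perimVals E := by
  refine ⟨fun _ => 0, contDiff_const, HasCompactSupport.zero, fun x => by simp, ?_⟩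
  simp [divg]

lemma perim_nonneg {n : ℕ} (E : Set (Euc n)) : 0 ≤ perim E := by
  by_cases h : BddAbove (perimVals E)
  · exact le_csSup h (zero_mem_perimVals E)
  · unfold perim; rw [Real.sSup_of_not_bddAbove h]

lemma perim_bound {n : ℕ} {E : Set (Euc n)} {b : ℝ} (h : ∀ r ∈ perimVals E, r ≤ b) :
    HasFinitePerim E ∧ perim E ≤ b :=
  ⟨⟨b, h⟩, csSup_le ⟨0, zero_mem_perimVals E⟩ h⟩

lemma divg_comp_smul {n : ℕ} (g : Euc n → Euc n) (hg : ContDiff ℝ 1 g) (c : ℝ) (x : Euc n) :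
    divg (fun y => g (c • y)) x = c * divg g (c • x) := by
  unfold divg
  rw [Finset.mul_sum]
  refine Finset.sum_congr rfl fun i _ => ?_
  have h1 : HasFDerivAt g (fderiv ℝ g (c • x)) (c • x) :=
    (hg.differentiable (by norm_num) _).hasFDerivAt
  have h2 : HasFDerivAt (fun y : Euc n => c • y) (c • ContinuousLinearMap.id ℝ (Euc n)) x :=
    (hasFDerivAt_id x).const_smul c
  have h3 : HasFDerivAt (fun y => g (c • y)) _ x := h1.comp x h2
  rw [h3.fderiv]
  simp

lemma perimVals_smul {n : ℕ} {c : ℝ} (hc : 0 < c) (E : Set (Euc n)) {r : ℝ}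
    (hr : r ∈ perimVals (c • E)) : c * (c ^ n)⁻¹ * r ∈ perimVals E := by
  obtain ⟨g, h1, h2, h3, rfl⟩ := hr
  refine ⟨fun y => g (c • y), h1.comp (contDiff_const_smul c), ?_, fun x => h3 _, ?_⟩
  · exact h2.comp_homeomorph (Homeomorph.smulOfNeZero c hc.ne')
  · simp_rw [divg_comp_smul g h1]
    rw [integral_const_mul, Measure.setIntegral_comp_smul_of_pos volume (divg g) E hc]
    simp [mul_assoc]

lemma perim_smul_le {n : ℕ} {c : ℝ} (hc : 0 < c) {E : Set (Euc n)} (hE : HasFinitePerim E) :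
    HasFinitePerim (c • E) ∧ perim (c • E) ≤ c ^ n * c⁻¹ * perim E := by
  refine perim_bound fun r hr => ?_
  have := le_csSup hE (perimVals_smul hc E hr)
  have h2 : 0 < c ^ n := by positivity
  calc r = c ^ n * c⁻¹ * (c * (c ^ n)⁻¹ * r) := by field_simp
    _ ≤ _ := by gcongr; exact this

lemma perim_smul {n : ℕ} {c : ℝ} (hc : 0 < c) {E : Set (Euc n)} (hE : HasFinitePerim E) :
    perim (c • E) = c ^ n * c⁻¹ * perim E := by
  refine le_antisymm (perim_smul_le hc hE).2 ?_
  have h := (perim_smul_le (inv_pos.2 hc) (perim_smul_le hc hE).1).2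
  rw [inv_smul_smul₀ hc.ne'] at h
  calc _ ≤ c ^ n * c⁻¹ * (c⁻¹ ^ n * c⁻¹⁻¹ * perim (c • E)) := by gcongr
    _ = _ := by rw [inv_pow]; field_simp

lemma perim_vadd_le {n : ℕ} (a : Euc n) {E : Set (Euc n)} (hE : HasFinitePerim E) :
    HasFinitePerim (a +ᵥ E) ∧ perim (a +ᵥ E) ≤ perim E := by
  refine perim_bound fun r hr => le_csSup hE ?_
  obtain ⟨g, h1, h2, h3, rfl⟩ := hr
  refine ⟨fun y => g (a + y), h1.comp (contDiff_const.add contDiff_id), ?_, fun x => h3 _, ?_⟩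
  · exact h2.comp_homeomorph (Homeomorph.addLeft a)
  · have : ∀ x, divg (fun y => g (a + y)) x = divg g (a + x) := by
      intro x; simp [divg, fderiv_comp_add_left]
    simp_rw [this]
    have hp : MeasurePreserving (fun x : Euc n => a + x) volume volume :=
      measurePreserving_add_left volume a
    rw [← hp.setIntegral_preimage_emb (measurableEmbedding_addLeft a)]
    congr 2
    ext x; simp [Set.mem_vadd_set_iff_neg_vadd_mem]

lemma continuous_divg {n : ℕ} {g : Euc n → Euc n} (hg : ContDiff ℝ 1 g) :
    Continuous (divg g) := by
  unfold divg
  have := hg.continuous_fderiv (by norm_num)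
  fun_prop

lemma integrable_divg {n : ℕ} {g : Euc n → Euc n} (hg : ContDiff ℝ 1 g)
    (hc : HasCompactSupport g) : Integrable (divg g) := by
  refine (continuous_divg hg).integrable_of_hasCompactSupport ?_
  have := hc.fderiv (𝕜 := ℝ)
  refine this.mono' ?_
  refine subset_trans ?_ subset_closure
  intro x hx
  rw [Function.mem_support] at hx ⊢
  intro h
  apply hx
  simp [divg, h]

lemma perim_union_le {n : ℕ} {A B : Set (Euc n)} (hB : MeasurableSet B) (hd : Disjoint A B)
    (hA' : HasFinitePerim A) (hB' : HasFinitePerim B) :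
    HasFinitePerim (A ∪ B) ∧ perim (A ∪ B) ≤ perim A + perim B := by
  refine perim_bound fun r hr => ?_
  obtain ⟨g, h1, h2, h3, rfl⟩ := hr
  have hi := integrable_divg h1 h2
  rw [setIntegral_union hd hB hi.integrableOn hi.integrableOn]
  exact add_le_add (le_csSup hA' ⟨g, h1, h2, h3, rfl⟩) (le_csSup hB' ⟨g, h1, h2, h3, rfl⟩)

/-- inner integral -/
def JJ (n : ℕ) (s : ℝ) (E : Set (Euc n)) (x : Euc n) : ℝ :=
  ∫ y : Euc n, |chi E x - chi E y| / ‖x - y‖ ^ ((n : ℝ) + s)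

lemma Ps_eq (n : ℕ) (s : ℝ) (E : Set (Euc n)) : Ps n s E = ∫ x, JJ n s E x := rfl

lemma JJ_nonneg (n : ℕ) (s : ℝ) (E : Set (Euc n)) (x : Euc n) : 0 ≤ JJ n s E x :=
  integral_nonneg fun y => by positivity

lemma Ps_nonneg (n : ℕ) (s : ℝ) (E : Set (Euc n)) : 0 ≤ Ps n s E :=
  integral_nonneg fun x => JJ_nonneg n s E x

lemma chi_smul {n : ℕ} {c : ℝ} (hc : 0 < c) (E : Set (Euc n)) (x : Euc n) :
    chi (c • E) (c • x) = chi E x := by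
  unfold chi
  by_cases h : x ∈ E
  · rw [indicator_of_mem h, indicator_of_mem (smul_mem_smul_set h)]; rfl
  · rw [indicator_of_notMem h, indicator_of_notMem]
    rwa [smul_mem_smul_set_iff₀ hc.ne']

lemma chi_vadd {n : ℕ} (a : Euc n) (E : Set (Euc n)) (x : Euc n) :
    chi (a +ᵥ E) (a + x) = chi E x := by
  unfold chi
  by_cases h : x ∈ E
  · rw [indicator_of_mem h, indicator_of_mem]
    · rfl
    · exact vadd_mem_vadd_set (a := a) h
  · rw [indicator_of_notMem h, indicator_of_notMem]
    change a +ᵥ x ∉ _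
    rwa [vadd_mem_vadd_set_iff]

lemma JJ_smul {n : ℕ} {s c : ℝ} (hc : 0 < c) (E : Set (Euc n)) (x : Euc n) :
    JJ n s (c • E) (c • x) = c ^ (-s) * JJ n s E x := by
  have h := Measure.integral_comp_smul_of_nonneg (volume : Measure (Euc n))
    (fun y => |chi (c • E) (c • x) - chi (c • E) y| / ‖c • x - y‖ ^ ((n : ℝ) + s)) c (hR := hc.le)
  simp only [chi_smul hc, ← smul_sub, norm_smul, Real.norm_eq_abs, abs_of_pos hc, smul_eq_mul,
    finrank_euclideanSpace, Fintype.card_fin] at h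
  unfold JJ
  simp only [chi_smul hc]
  have h2 : ∀ y, |chi E x - chi E y| / (c * ‖x - y‖) ^ ((n : ℝ) + s) =
     c ^ (-((n : ℝ) + s)) * (|chi E x - chi E y| / ‖x - y‖ ^ ((n : ℝ) + s)) := by
    intro y
    rw [Real.mul_rpow hc.le (norm_nonneg _), Real.rpow_neg hc.le]
    rw [mul_comm, div_eq_mul_inv, div_eq_mul_inv, mul_inv]; ring
  simp_rw [h2] at h
  rw [integral_const_mul] at h
  have h3 : c ^ n ≠ 0 := by positivity
  rw [eq_inv_mul_iff_mul_eq₀ h3] at h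
  rw [← h, ← mul_assoc, ← Real.rpow_natCast, ← Real.rpow_add hc]
  congr 2; ring

lemma Ps_smul {n : ℕ} {s c : ℝ} (hc : 0 < c) (E : Set (Euc n)) :
    Ps n s (c • E) = c ^ n * c ^ (-s) * Ps n s E := by
  have h := Measure.integral_comp_smul_of_nonneg (volume : Measure (Euc n))
    (JJ n s (c • E)) c (hR := hc.le)
  simp only [JJ_smul hc, smul_eq_mul, finrank_euclideanSpace, Fintype.card_fin] at h
  rw [integral_const_mul, eq_inv_mul_iff_mul_eq₀ (by positivity)] at h
  rw [Ps_eq, Ps_eq, ← h]; ring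

lemma JJ_vadd {n : ℕ} {s : ℝ} (a : Euc n) (E : Set (Euc n)) (x : Euc n) :
    JJ n s (a +ᵥ E) (a + x) = JJ n s E x := by
  unfold JJ
  rw [← integral_add_left_eq_self (μ := volume) _ a]
  simp only [chi_vadd, add_sub_add_left_eq_sub]

lemma Ps_vadd {n : ℕ} {s : ℝ} (a : Euc n) (E : Set (Euc n)) :
    Ps n s (a +ᵥ E) = Ps n s E := by
  rw [Ps_eq, Ps_eq, ← integral_add_left_eq_self (μ := volume) _ a]
  simp only [JJ_vadd]

lemma vol_smul {n : ℕ} {c : ℝ} (hc : 0 < c) (E : Set (Euc n)) :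
    volume (c • E) = ENNReal.ofReal (c ^ n) * volume E := by
  rw [Measure.addHaar_smul, abs_of_pos (by positivity)]
  simp

lemma chi_meas {n : ℕ} {E : Set (Euc n)} (hE : MeasurableSet E) : Measurable (chi E) :=
  measurable_one.indicator hE

lemma chi_mem {n : ℕ} {E : Set (Euc n)} {x : Euc n} (h : x ∈ E) : chi E x = 1 := by
  simp [chi, h]

lemma chi_notMem {n : ℕ} {E : Set (Euc n)} {x : Euc n} (h : x ∉ E) : chi E x = 0 := by
  simp [chi, h]

/-- Comparison of the inner integrals for two sets that differ only far away from `x`. -/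
lemma JJ_compare {n : ℕ} {s D : ℝ} (hs : 0 < s) (hD : 0 < D) {A U O : Set (Euc n)}
    (hA : MeasurableSet A) (hU : MeasurableSet U) (hO : MeasurableSet O)
    (hOf : volume O ≠ ∞) (hAU : ∀ y, y ∉ O → (y ∈ A ↔ y ∈ U)) (x : Euc n)
    (hx : ∀ y ∈ O, D ≤ ‖x - y‖) :
    JJ n s A x - (D ^ ((n : ℝ) + s))⁻¹ * volume.real O ≤ JJ n s U x := by
  set K : Euc n → ℝ := fun y => ‖x - y‖ ^ ((n : ℝ) + s) with hK
  have hKm : Measurable K := by fun_prop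
  set f : Set (Euc n) → Euc n → ℝ := fun E y => |chi E x - chi E y| / K y with hf
  have hfm : ∀ E, MeasurableSet E → Measurable (f E) := fun E hE => by
    have := chi_meas hE
    fun_prop
  have hxO : x ∉ O := fun h => by
    have := hx x h; simp at this; linarith
  have hchi : ∀ y, y ∉ O → chi A y = chi U y := fun y hy => by
    by_cases h : y ∈ A
    · rw [chi_mem h, chi_mem ((hAU y hy).1 h)]
    · rw [chi_notMem h, chi_notMem (fun h' => h ((hAU y hy).2 h'))]
  have hc01 : ∀ (E : Set (Euc n)) y, 0 ≤ chi E y ∧ chi E y ≤ 1 := fun E y => by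
    by_cases h : y ∈ E
    · rw [chi_mem h]; norm_num
    · rw [chi_notMem h]; norm_num
  set h : Euc n → ℝ := O.indicator (fun _ => (D ^ ((n : ℝ) + s))⁻¹) with hh
  have hhi : Integrable h := (integrableOn_const hOf).integrable_indicator hO
  have key : ∀ y, |f A y - f U y| ≤ h y := by
    intro y
    by_cases hy : y ∈ O
    · rw [hh, indicator_of_mem hy]
      have hKD : D ^ ((n : ℝ) + s) ≤ K y := Real.rpow_le_rpow hD.le (hx y hy) (by positivity)
      have hD' : 0 < D ^ ((n : ℝ) + s) := by positivity
      simp only [hf]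
      rw [← sub_div, abs_div, abs_of_pos (hD'.trans_le hKD), inv_eq_one_div]
      gcongr
      have a1 := hc01 A y
      have a2 := hc01 U y
      have a3 := hc01 U x
      rw [hchi x hxO]
      have b1 : ∀ E : Set (Euc n), 0 ≤ |chi U x - chi E y| ∧ |chi U x - chi E y| ≤ 1 := fun E => by
        refine ⟨abs_nonneg _, abs_le.2 ⟨?_, ?_⟩⟩ <;> linarith [hc01 E y, hc01 U x, (hc01 E y).1, (hc01 E y).2, a3.1, a3.2]
      rw [abs_le]
      constructor <;> linarith [(b1 A).1, (b1 A).2, (b1 U).1, (b1 U).2]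
    · rw [hh, indicator_of_notMem hy]
      simp [hf, hchi x hxO, hchi y hy]
  have hint : ∫ y, h y = (D ^ ((n : ℝ) + s))⁻¹ * volume.real O := by
    rw [hh, integral_indicator hO, setIntegral_const, smul_eq_mul, mul_comm]
  by_cases hi : Integrable (f A)
  · have hd : Integrable (fun y => f A y - f U y) :=
      hhi.mono' ((hfm A hA).sub (hfm U hU)).aestronglyMeasurable
        (Eventually.of_forall fun y => by rw [Real.norm_eq_abs]; exact key y)
    have hiU : Integrable (f U) := by
      have := hi.sub hd
      refine this.congr (Eventually.of_forall fun y => ?_)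
      simp
    have h1 : JJ n s A x - JJ n s U x = ∫ y, (f A y - f U y) := (integral_sub hi hiU).symm
    have h2 : ∫ y, (f A y - f U y) ≤ ∫ y, h y :=
      integral_mono hd hhi fun y => (le_abs_self _).trans (key y)
    linarith
  · have h1 : JJ n s A x = 0 := integral_undef hi
    have h2 := JJ_nonneg n s U x
    have h3 : 0 ≤ (D ^ ((n : ℝ) + s))⁻¹ * volume.real O := by positivity
    linarith

lemma JJ_integrable {n : ℕ} {s : ℝ} {E : Set (Euc n)} (h : 0 < Ps n s E) :
    Integrable (JJ n s E) := by
  by_contra hc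
  rw [Ps_eq, integral_undef hc] at h
  exact lt_irrefl _ h

lemma Ps_compare {n : ℕ} {s D L : ℝ} (hs : 0 < s) (hD : 0 < D) {A U O : Set (Euc n)}
    (hA : MeasurableSet A) (hU : MeasurableSet U) (hO : MeasurableSet O)
    (hOf : volume O ≠ ∞) (hAU : ∀ y, y ∉ O → (y ∈ A ↔ y ∈ U)) (c : Euc n)
    (hx : ∀ x ∈ ball c L, ∀ y ∈ O, D ≤ ‖x - y‖)
    (hpA : 0 < Ps n s A) (hpU : 0 < Ps n s U) :
    (∫ x in ball c L, JJ n s A x) -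
      (D ^ ((n : ℝ) + s))⁻¹ * volume.real O * volume.real (ball c L) ≤
      ∫ x in ball c L, JJ n s U x := by
  have iA := (JJ_integrable hpA).integrableOn (s := ball c L)
  have iU := (JJ_integrable hpU).integrableOn (s := ball c L)
  have hb : volume (ball c L) ≠ ∞ := measure_ball_lt_top.ne
  have hi := integrableOn_const (μ := volume) (s := ball c L) hb
    (C := (D ^ ((n : ℝ) + s))⁻¹ * volume.real O)
  have := setIntegral_mono_on (iA.sub hi) iU measurableSet_ball
    (fun x hx' => JJ_compare hs hD hA hU hO hOf hAU x (hx x hx'))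
  simp only [Pi.sub_apply] at this
  rw [integral_sub iA hi, setIntegral_const, smul_eq_mul] at this
  linarith [mul_comm (volume.real (ball c L)) ((D ^ ((n : ℝ) + s))⁻¹ * volume.real O)]

lemma Ps_ball {n : ℕ} {s : ℝ} {A : Set (Euc n)} (hp : 0 < Ps n s A) {δ : ℝ} (hδ : 0 < δ) :
    ∀ᶠ L : ℝ in atTop, Ps n s A - δ ≤ ∫ x in ball 0 L, JJ n s A x := by
  have h := (aecover_ball (μ := (volume : Measure (Euc n))) (x := 0)
    tendsto_id).integral_tendsto_of_countably_generated (JJ_integrable hp)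
  have h2 := h.eventually (lt_mem_nhds (show Ps n s A - δ < ∫ x, JJ n s A x by
    rw [← Ps_eq]; linarith))
  filter_upwards [h2] with L hL using hL.le

lemma tendsto_inv_rpow (n : ℕ) {s : ℝ} (hs : 0 < s) (C : ℝ) :
    Tendsto (fun D : ℝ => (D ^ ((n : ℝ) + s))⁻¹ * C) atTop (nhds 0) := by
  have h := (tendsto_rpow_atTop (show 0 < (n : ℝ) + s by positivity)).inv_tendsto_atTop
  simpa using h.mul_const C

/-- Truncation does not decrease `Ps` much. -/
lemma Ps_trunc {n : ℕ} {s : ℝ} (hs : 0 < s) {F : Set (Euc n)} (hF : MeasurableSet F)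
    (hFv : volume F ≠ ∞) (hp : 0 < Ps n s F) {δ : ℝ} (hδ : 0 < δ) :
    ∀ᶠ R : ℝ in atTop, 0 < Ps n s (F ∩ closedBall 0 R) →
      Ps n s F - δ ≤ Ps n s (F ∩ closedBall 0 R) := by
  obtain ⟨L, hL⟩ := (Ps_ball hp (half_pos hδ)).exists
  have h1 := (tendsto_inv_rpow n hs (volume.real F * volume.real (ball (0 : Euc n) L))).eventually
    (gt_mem_nhds (half_pos hδ))
  have h2 : Tendsto (fun R : ℝ => R - L) atTop atTop := tendsto_atTop_add_const_right _ _ tendsto_id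
  filter_upwards [h2.eventually h1, eventually_gt_atTop L] with R hR hRL hpos
  have hD : 0 < R - L := by linarith
  have hsub : F \ closedBall 0 R ⊆ F := sdiff_subset
  have := Ps_compare (n := n) (s := s) (D := R - L) (L := L) hs hD (A := F)
    (U := F ∩ closedBall 0 R) (O := F \ closedBall 0 R) hF
    (hF.inter measurableSet_closedBall) (hF.diff measurableSet_closedBall)
    (measure_ne_top_of_subset hsub hFv)
    (fun y hy => by simp only [Set.mem_sdiff, mem_inter_iff] at *; tauto) 0
    (fun x hx y hy => by
      have h1 : ‖x‖ < L := by simpa using hx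
      have h2 : R < ‖y‖ := by simpa using hy.2
      have := norm_sub_norm_le y x
      rw [norm_sub_rev]; linarith) hp hpos
  have hmono : volume.real (F \ closedBall 0 R) ≤ volume.real F := measureReal_mono hsub hFv
  have hle : ∫ x in ball 0 L, JJ n s (F ∩ closedBall 0 R) x ≤ Ps n s (F ∩ closedBall 0 R) :=
    setIntegral_le_integral (JJ_integrable hpos) (Eventually.of_forall fun x => JJ_nonneg _ _ _ _)
  have : (((R - L) ^ ((n : ℝ) + s))⁻¹ * volume.real (F \ closedBall 0 R) *
      volume.real (ball (0 : Euc n) L)) ≤ ((R - L) ^ ((n : ℝ) + s))⁻¹ *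
      (volume.real F * volume.real (ball (0 : Euc n) L)) := by
    rw [mul_assoc]; gcongr
  linarith

/-- Far away unions. -/
lemma Ps_union {n : ℕ} (hn : 0 < n) {s : ℝ} (hs : 0 < s) {U A : Set (Euc n)}
    (hU : MeasurableSet U) (hA : MeasurableSet A)
    (bU : Bornology.IsBounded U) (bA : Bornology.IsBounded A)
    (hpU : 0 < Ps n s U) (hpA : 0 < Ps n s A) {δ : ℝ} (hδ : 0 < δ) :
    ∃ a : Euc n, Disjoint U (a +ᵥ A) ∧ (0 < Ps n s (U ∪ (a +ᵥ A)) →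
      Ps n s U + Ps n s A - δ ≤ Ps n s (U ∪ (a +ᵥ A))) := by
  obtain ⟨r, hrU, hrA⟩ : ∃ r : ℝ, (∀ y ∈ U, ‖y‖ ≤ r) ∧ (∀ y ∈ A, ‖y‖ ≤ r) := by
    obtain ⟨r, hr⟩ := isBounded_iff_forall_norm_le.1 (bU.union bA)
    exact ⟨r, fun y hy => hr y (Or.inl hy), fun y hy => hr y (Or.inr hy)⟩
  have hδ4 : 0 < δ / 4 := by positivity
  obtain ⟨L, ⟨hL1, hL2⟩, hL0, hLr⟩ := (((Ps_ball hpU hδ4).and (Ps_ball hpA hδ4)).and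
    ((eventually_gt_atTop 0).and (eventually_ge_atTop r))).exists
  set b := volume.real (ball (0 : Euc n) L) with hb
  obtain ⟨D, ⟨hD1, hD2⟩, hD0⟩ := (((tendsto_inv_rpow n hs (volume.real U * b)).eventually
    (gt_mem_nhds hδ4)).and ((tendsto_inv_rpow n hs (volume.real A * b)).eventually
    (gt_mem_nhds hδ4)) |>.and (eventually_gt_atTop 0)).exists
  set a : Euc n := EuclideanSpace.single ⟨0, hn⟩ (2 * L + D) with ha
  have hna : ‖a‖ = 2 * L + D := by
    rw [ha, PiLp.norm_single, Real.norm_eq_abs, abs_of_pos (by positivity)]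
  have mem : ∀ y, y ∈ a +ᵥ A ↔ y - a ∈ A := fun y => by
    rw [mem_vadd_set_iff_neg_vadd_mem, vadd_eq_add, neg_add_eq_sub]
  have hdisj : Disjoint U (a +ᵥ A) := by
    rw [Set.disjoint_left]
    intro y hy hy'
    have h1 := hrU y hy
    have h2 := hrA _ ((mem y).1 hy')
    have h3 := norm_sub_le y (y - a)
    rw [sub_sub_cancel, hna] at h3
    linarith
  refine ⟨a, hdisj, fun hpos => ?_⟩
  have hA2 : MeasurableSet (a +ᵥ A) := hA.const_vadd a
  set W := U ∪ (a +ᵥ A) with hW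
  have hWm : MeasurableSet W := hU.union hA2
  have vA : volume (a +ᵥ A) = volume A := measure_vadd volume a A
  have vAr : volume.real (a +ᵥ A) = volume.real A := by simp [measureReal_def, vA]
  have fU : volume U ≠ ∞ := bU.measure_lt_top.ne
  have fA : volume A ≠ ∞ := bA.measure_lt_top.ne
  have c1 := Ps_compare (n := n) (s := s) (D := D) (L := L) hs hD0 (A := U)
    (U := W) (O := a +ᵥ A) hU hWm hA2 (by rw [vA]; exact fA)
    (fun y hy => by simp only [hW, mem_union]; tauto) 0
    (fun x hx y hy => by
      have h1 : ‖x‖ < L := by simpa using hx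
      have h2 := hrA _ ((mem y).1 hy)
      have h3 : ‖a‖ ≤ ‖x‖ + ‖y - a‖ + ‖x - y‖ := by
        calc ‖a‖ = ‖x - (y - a) - (x - y)‖ := by congr 1; abel
          _ ≤ ‖x - (y - a)‖ + ‖x - y‖ := norm_sub_le _ _
          _ ≤ _ := by gcongr; exact norm_sub_le _ _
      rw [hna] at h3
      linarith) hpU hpos
  have c2 := Ps_compare (n := n) (s := s) (D := D) (L := L) hs hD0 (A := a +ᵥ A)
    (U := W) (O := U) hA2 hWm hU fU
    (fun y hy => by simp only [hW, mem_union]; tauto) a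
    (fun x hx y hy => by
      have h1 : ‖x - a‖ < L := by simpa [dist_eq_norm] using hx
      have h2 := hrU _ hy
      have h3 : ‖a‖ ≤ ‖x - a‖ + ‖y‖ + ‖x - y‖ := by
        calc ‖a‖ = ‖x - y - ((x - a) - y)‖ := by congr 1; abel
          _ ≤ ‖x - y‖ + ‖(x - a) - y‖ := norm_sub_le _ _
          _ ≤ ‖x - y‖ + (‖x - a‖ + ‖y‖) := by gcongr; exact norm_sub_le _ _
          _ = _ := by ring
      rw [hna] at h3
      linarith) (by rw [Ps_vadd]; exact hpA) hpos
  have hball : volume.real (ball a L) = b := by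
    rw [hb, measureReal_def, measureReal_def, Measure.addHaar_ball_center]
  have htr : ∫ x in ball a L, JJ n s (a +ᵥ A) x = ∫ x in ball 0 L, JJ n s A x := by
    have hp : MeasurePreserving (fun x : Euc n => a + x) volume volume :=
      measurePreserving_add_left volume a
    rw [← hp.setIntegral_preimage_emb (measurableEmbedding_addLeft a)]
    simp only [JJ_vadd]
    congr 2
    ext x; simp [dist_eq_norm]
  have hbd : Disjoint (ball (0 : Euc n) L) (ball a L) := by
    apply ball_disjoint_ball
    rw [dist_comm, dist_zero_right, hna]; linarith
  have iW := JJ_integrable hpos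
  have hsum : (∫ x in ball 0 L, JJ n s W x) + ∫ x in ball a L, JJ n s W x ≤ Ps n s W := by
    rw [← setIntegral_union hbd measurableSet_ball iW.integrableOn iW.integrableOn]
    exact setIntegral_le_integral iW (Eventually.of_forall fun x => JJ_nonneg _ _ _ _)
  rw [htr, hball] at c2
  rw [vAr] at c1
  rw [mul_assoc] at c1 c2
  linarith

lemma exists_slope {v : ℝ → ℝ} (hv : Monotone v) {V T : ℝ} (h0 : ∀ t, 0 ≤ v t)
    (hV : ∀ t, v t ≤ V) (hT : 0 < T) :
    ∃ t, T ≤ t ∧ t ≤ 2 * T ∧ DifferentiableAt ℝ v t ∧ deriv v t ≤ V / T := by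
  by_contra! hcon
  have hle : T ≤ 2 * T := by linarith
  have h1 : ∫ t in T..(2 * T), deriv v t ≤ V := by
    have := (hv.monotoneOn (uIcc T (2 * T))).intervalIntegral_deriv_mem_uIcc
    rw [uIcc_of_le (sub_nonneg.2 (hv hle))] at this
    linarith [this.2, hV (2 * T), h0 T]
  have hi := (hv.monotoneOn (uIcc T (2 * T))).intervalIntegrable_deriv
  rw [intervalIntegral.integral_of_le hle] at h1
  rw [intervalIntegrable_iff_integrableOn_Ioc_of_le hle] at hi
  have hvol : (volume (Ioc T (2 * T))) ≠ 0 := by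
    rw [Real.volume_Ioc]; simp; linarith
  have hvol2 : (volume.restrict (Ioc T (2 * T))) ≠ 0 := by
    rwa [Ne, Measure.restrict_eq_zero]
  have hN : volume.restrict (Ioc T (2 * T)) {t | ¬ (DifferentiableAt ℝ v t ∧ t ∈ Ioc T (2 * T))} = 0 := by
    have e1 : ∀ᵐ t ∂(volume.restrict (Ioc T (2 * T))), DifferentiableAt ℝ v t :=
      ae_restrict_of_ae hv.ae_differentiableAt
    have e2 : ∀ᵐ t ∂(volume.restrict (Ioc T (2 * T))), t ∈ Ioc T (2 * T) :=
      ae_restrict_mem measurableSet_Ioc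
    exact ae_iff.1 (e1.and e2)
  have : IsFiniteMeasure (volume.restrict (Ioc T (2 * T))) := by
    refine ⟨?_⟩; simp
  obtain ⟨t, ht, ht2⟩ := exists_notMem_null_le_average hvol2 hi hN
  simp only [Set.mem_ofPred_eq, not_not] at ht
  have h3 := hcon t ht.2.1.le ht.2.2 ht.1
  rw [average_eq, smul_eq_mul] at ht2
  have h4 : (volume.restrict (Ioc T (2 * T))).real univ = T := by
    simp [measureReal_def, Real.volume_Ioc]; rw [ENNReal.toReal_ofReal] <;> linarith
  rw [h4] at ht2
  have : T⁻¹ * ∫ t in Ioc T (2 * T), deriv v t ≤ V / T := by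
    rw [div_eq_inv_mul]; gcongr
  linarith

/-- cutoff profile -/
def cutf (u : ℝ) : ℝ := Real.smoothTransition (1 - u)

lemma cutf_contDiff : ContDiff ℝ 1 cutf :=
  (Real.smoothTransition.contDiff (n := 1)).comp (contDiff_const.sub contDiff_id)

lemma cutf_one {u : ℝ} (h : u ≤ 0) : cutf u = 1 :=
  Real.smoothTransition.one_of_one_le (by linarith)

lemma cutf_zero {u : ℝ} (h : 1 ≤ u) : cutf u = 0 :=
  Real.smoothTransition.zero_of_nonpos (by linarith)

lemma cutf_nonneg (u : ℝ) : 0 ≤ cutf u := Real.smoothTransition.nonneg _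

lemma cutf_le_one (u : ℝ) : cutf u ≤ 1 := Real.smoothTransition.le_one _

attribute [irreducible] cutf

lemma cutf_deriv_zero {u : ℝ} (h : u ∉ Ioc (0 : ℝ) 1) : deriv cutf u = 0 := by
  have : u ≤ 0 ∨ 1 < u := by
    by_contra! h'
    exact h ⟨h'.1, h'.2⟩
  have hnn := cutf_nonneg
  have hle := cutf_le_one
  rcases this with h | h
  · exact IsLocalMax.deriv_eq_zero (Eventually.of_forall fun w => by
      rw [cutf_one h]; exact hle w)
  · exact IsLocalMin.deriv_eq_zero (Eventually.of_forall fun w => by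
      rw [cutf_zero h.le]; exact hnn w)

lemma cutf_deriv_bdd : ∃ C : ℝ, 0 < C ∧ ∀ u, |deriv cutf u| ≤ C := by
  have hc : Continuous (deriv cutf) := cutf_contDiff.continuous_deriv le_rfl
  obtain ⟨C, hC⟩ := (isCompact_Icc (a := (0 : ℝ)) (b := 1)).exists_bound_of_continuousOn
    hc.continuousOn
  refine ⟨max C 1, by positivity, fun u => ?_⟩
  by_cases h : u ∈ Ioc (0 : ℝ) 1
  · exact (hC u ⟨h.1.le, h.2⟩).trans (le_max_left _ _)
  · rw [cutf_deriv_zero h]; simp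

lemma divg_smul {n : ℕ} {η : Euc n → ℝ} {g : Euc n → Euc n} (hη : ContDiff ℝ 1 η)
    (hg : ContDiff ℝ 1 g) (x : Euc n) :
    divg (fun y => η y • g y) x = η x * divg g x + fderiv ℝ η x (g x) := by
  have h1 := (hη.differentiable (by norm_num) x).hasFDerivAt
  have h2 := (hg.differentiable (by norm_num) x).hasFDerivAt
  have h3 : HasFDerivAt (fun y => η y • g y) _ x := h1.smul h2
  have h4 : g x = ∑ i, g x i • EuclideanSpace.single i (1 : ℝ) := by
    ext j
    simp [Finset.sum_apply, Pi.single_apply]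
  conv_rhs => rw [h4]
  unfold divg
  rw [h3.fderiv, map_sum, Finset.mul_sum, ← Finset.sum_add_distrib]
  refine Finset.sum_congr rfl fun i _ => ?_
  simp
  ring

set_option maxHeartbeats 1000000 in
lemma perim_trunc {n : ℕ} {F : Set (Euc n)} (hF : MeasurableSet F) (hFv : volume F ≠ ∞)
    (hP : HasFinitePerim F) {C : ℝ} (hC : ∀ u, |deriv cutf u| ≤ C) {T : ℝ} (hT : 0 < T) :
    ∃ t, T ≤ t ∧ HasFinitePerim (F ∩ closedBall 0 (√t)) ∧
      perim (F ∩ closedBall 0 (√t)) ≤ perim F + 2 * C * √(2 * T) * (volume.real F / T) := by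
  have hC0 : 0 ≤ C := (abs_nonneg _).trans (hC 0)
  set S : ℝ → Set (Euc n) := fun t => {x | ‖x‖ ^ 2 ≤ t} with hS
  have hSm : ∀ t, MeasurableSet (S t) := fun t => measurableSet_le (by fun_prop) (by fun_prop)
  set v : ℝ → ℝ := fun t => volume.real (F ∩ S t) with hv
  have hvm : Monotone v := fun a b hab =>
    measureReal_mono (inter_subset_inter_right _ fun x hx => le_trans hx hab)
      (measure_ne_top_of_subset inter_subset_left hFv)
  obtain ⟨t, htT, ht2, hd, hdle⟩ := exists_slope hvm (V := volume.real F) (T := T)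
    (fun t => measureReal_nonneg) (fun t => measureReal_mono inter_subset_left hFv) hT
  have ht0 : 0 < t := by linarith
  refine ⟨t, htT, ?_⟩
  have hSt : closedBall (0 : Euc n) (√t) = S t := by
    ext x
    simp only [mem_closedBall, dist_zero_right, hS, Set.mem_ofPred_eq]
    exact Real.le_sqrt (norm_nonneg _) ht0.le
  rw [hSt]
  refine perim_bound fun r hr => ?_
  obtain ⟨g, g1, g2, g3, rfl⟩ := hr
  -- cutoff functions
  set δ : ℕ → ℝ := fun j => 1 / ((j : ℝ) + 1) with hδ
  have hδ0 : ∀ j, 0 < δ j := fun j => by positivity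
  have hδlim : Tendsto δ atTop (nhds 0) := tendsto_one_div_add_atTop_nhds_zero_nat
  set η : ℕ → Euc n → ℝ := fun j x => cutf ((‖x‖ ^ 2 - t) / δ j) with hη
  have hηc : ∀ j, ContDiff ℝ 1 (η j) := fun j =>
    cutf_contDiff.comp (((contDiff_norm_sq ℝ).sub contDiff_const).div_const _)
  have hη0 : ∀ j x, 0 ≤ η j x := fun j x => cutf_nonneg _
  have hη1 : ∀ j x, η j x ≤ 1 := fun j x => cutf_le_one _
  have hgi := integrable_divg g1 g2
  -- bound for each j
  have hfd : ∀ j x, |fderiv ℝ (η j) x (g x)| ≤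
      (S (t + δ j) \ S t).indicator (fun _ => C * (2 * √(t + δ j) / δ j)) x := by
    intro j x
    have hN : HasFDerivAt (fun x : Euc n => (‖x‖ ^ 2 - t) / δ j)
        ((δ j)⁻¹ • (2 • (innerSL ℝ x))) x := by
      have := ((hasStrictFDerivAt_norm_sq x).hasFDerivAt.sub_const t).const_mul (δ j)⁻¹
      simpa [div_eq_inv_mul] using this
    have hcd : HasDerivAt cutf (deriv cutf ((‖x‖ ^ 2 - t) / δ j)) ((‖x‖ ^ 2 - t) / δ j) :=
      (cutf_contDiff.differentiable (by norm_num) _).hasDerivAt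
    have hcomp := hcd.comp_hasFDerivAt x hN
    change HasFDerivAt (η j) _ x at hcomp
    rw [hcomp.fderiv]
    have hval : (deriv cutf ((‖x‖ ^ 2 - t) / δ j) • ((δ j)⁻¹ • (2 • (innerSL ℝ x)))) (g x) =
      deriv cutf ((‖x‖ ^ 2 - t) / δ j) * (2 * inner ℝ x (g x) / δ j) := by
      simp [div_eq_inv_mul]
    rw [hval, abs_mul]
    by_cases hx : x ∈ S (t + δ j) \ S t
    · rw [indicator_of_mem hx]
      have hxn : ‖x‖ ≤ √(t + δ j) := Real.le_sqrt_of_sq_le hx.1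
      refine mul_le_mul (hC _) ?_ (abs_nonneg _) hC0
      rw [abs_div, abs_of_pos (hδ0 j), abs_mul, abs_two]
      have : |inner ℝ x (g x)| ≤ √(t + δ j) := by
        refine (abs_real_inner_le_norm _ _).trans ?_
        calc ‖x‖ * ‖g x‖ ≤ ‖x‖ * 1 := by gcongr; exact g3 x
          _ ≤ _ := by rwa [mul_one]
      have := hδ0 j
      gcongr
    · rw [indicator_of_notMem hx, cutf_deriv_zero]
      · simp
      · intro h
        apply hx
        have h1 := h.1
        have h2 := h.2
        rw [div_le_one (hδ0 j)] at h2
        have h3 := (div_pos_iff_of_pos_right (hδ0 j)).1 h1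
        constructor
        · change ‖x‖ ^ 2 ≤ t + δ j
          linarith
        · change ¬ (‖x‖ ^ 2 ≤ t)
          linarith
  have hstep : ∀ j, ∫ x in F, η j x * divg g x ≤
      perim F + 2 * C * √(t + δ j) * ((v (t + δ j) - v t) / δ j) := by
    intro j
    have hcs : HasCompactSupport (fun y => η j y • g y) := HasCompactSupport.smul_left (f := η j) g2
    have hmem : (∫ x in F, divg (fun y => η j y • g y) x) ∈ perimVals F := by
      refine ⟨fun y => η j y • g y, (hηc j).smul g1, hcs, fun x => ?_, rfl⟩
      rw [norm_smul, Real.norm_eq_abs, abs_of_nonneg (hη0 j x)]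
      exact mul_le_one₀ (hη1 j x) (norm_nonneg _) (g3 x)
    have hle : (∫ x in F, divg (fun y => η j y • g y) x) ≤ perim F := le_csSup hP hmem
    simp_rw [divg_smul (hηc j) g1] at hle
    have hi1 : IntegrableOn (fun x => η j x * divg g x) F := by
      refine (hgi.bdd_mul (hηc j).continuous.aestronglyMeasurable (c := 1)
        (Eventually.of_forall fun x => ?_)).integrableOn
      rw [Real.norm_eq_abs, abs_of_nonneg (hη0 j x)]; exact hη1 j x
    have hSd : MeasurableSet (S (t + δ j) \ S t) := (hSm _).diff (hSm _)
    have hi3 : IntegrableOn ((S (t + δ j) \ S t).indicator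
        (fun _ => C * (2 * √(t + δ j) / δ j))) F :=
      (integrableOn_const hFv).indicator hSd
    have hi2 : IntegrableOn (fun x => fderiv ℝ (η j) x (g x)) F := by
      refine Integrable.mono' hi3 ?_ (Eventually.of_forall fun x => hfd j x)
      have h1 := (hηc j).continuous_fderiv (by norm_num)
      have h2 := g1.continuous
      exact (h1.clm_apply h2).aestronglyMeasurable
    rw [integral_add hi1 hi2] at hle
    have h5 : -(∫ x in F, fderiv ℝ (η j) x (g x)) ≤
        ∫ x in F, (S (t + δ j) \ S t).indicator (fun _ => C * (2 * √(t + δ j) / δ j)) x := by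
      rw [← integral_neg]
      exact integral_mono hi2.neg hi3 fun x => (neg_le_abs _).trans (hfd j x)
    have h6 : ∫ x in F, (S (t + δ j) \ S t).indicator (fun _ => C * (2 * √(t + δ j) / δ j)) x
        = 2 * C * √(t + δ j) * ((v (t + δ j) - v t) / δ j) := by
      rw [setIntegral_indicator hSd, setIntegral_const, smul_eq_mul]
      have : volume.real (F ∩ (S (t + δ j) \ S t)) = v (t + δ j) - v t := by
        have hset : F ∩ (S (t + δ j) \ S t) = (F ∩ S (t + δ j)) \ (F ∩ S t) := by
          ext x; simp only [mem_inter_iff, Set.mem_sdiff]; tauto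
        rw [hset]
        refine measureReal_sdiff ?_ (hF.inter (hSm _)) (measure_ne_top_of_subset inter_subset_left hFv)
        exact inter_subset_inter_right _ fun x hx => le_trans hx (le_add_of_nonneg_right (hδ0 j).le)
      rw [this]; ring
    linarith
  -- limit of the left side
  have hlim1 : Tendsto (fun j => ∫ x in F, η j x * divg g x) atTop
      (nhds (∫ x in F, (S t).indicator (divg g) x)) := by
    refine tendsto_integral_of_dominated_convergence (fun x => |divg g x|) ?_
      hgi.abs.integrableOn ?_ ?_
    · intro j
      exact ((hηc j).continuous.mul (continuous_divg g1)).aestronglyMeasurable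
    · intro j
      refine Eventually.of_forall fun x => ?_
      rw [norm_mul, Real.norm_eq_abs, Real.norm_eq_abs, abs_of_nonneg (hη0 j x)]
      exact mul_le_of_le_one_left (abs_nonneg _) (hη1 j x)
    · refine Eventually.of_forall fun x => ?_
      by_cases hx : x ∈ S t
      · rw [indicator_of_mem hx]
        have : ∀ j, η j x = 1 := fun j => cutf_one (by
          have h1 : ‖x‖ ^ 2 ≤ t := hx
          exact div_nonpos_of_nonpos_of_nonneg (by linarith) (hδ0 j).le)
        simp [this]
      · rw [indicator_of_notMem hx]
        have h1 : t < ‖x‖ ^ 2 := not_le.1 hx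
        have h2 : ∀ᶠ j in atTop, δ j < ‖x‖ ^ 2 - t :=
          hδlim.eventually (gt_mem_nhds (by linarith))
        refine tendsto_const_nhds.congr' ?_
        filter_upwards [h2] with j hj
        have : η j x = 0 := cutf_zero (by rw [le_div_iff₀ (hδ0 j)]; linarith)
        rw [this, zero_mul]
  rw [setIntegral_indicator (hSm t)] at hlim1
  have hlim2 : Tendsto (fun j => perim F + 2 * C * √(t + δ j) * ((v (t + δ j) - v t) / δ j)) atTop
      (nhds (perim F + 2 * C * √(t + 0) * deriv v t)) := by
    have hsl : Tendsto (fun j => (v (t + δ j) - v t) / δ j) atTop (nhds (deriv v t)) := by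
      have h1 := hd.hasDerivAt.tendsto_slope_zero
      have h2 : Tendsto δ atTop (nhdsWithin 0 {0}ᶜ) :=
        tendsto_nhdsWithin_iff.2 ⟨hδlim, Eventually.of_forall fun j => (hδ0 j).ne'⟩
      have h3 := h1.comp h2
      refine h3.congr fun j => ?_
      simp [div_eq_inv_mul]
    have hsq : Tendsto (fun j => √(t + δ j)) atTop (nhds (√(t + 0))) :=
      (Real.continuous_sqrt.tendsto _).comp (tendsto_const_nhds.add hδlim)
    exact tendsto_const_nhds.add ((tendsto_const_nhds.mul hsq).mul hsl)
  have hfin := le_of_tendsto_of_tendsto' hlim1 hlim2 hstep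
  refine hfin.trans ?_
  rw [add_zero]
  have hd0 : 0 ≤ deriv v t := hvm.deriv_nonneg
  gcongr

lemma perim_trunc' {n : ℕ} {F : Set (Euc n)} (hF : MeasurableSet F) (hFv : volume F ≠ ∞)
    (hP : HasFinitePerim F) {ε : ℝ} (hε : 0 < ε) :
    ∃ᶠ R : ℝ in atTop, HasFinitePerim (F ∩ closedBall 0 R) ∧
      perim (F ∩ closedBall 0 R) ≤ perim F + ε := by
  obtain ⟨C, hC0, hC⟩ := cutf_deriv_bdd
  have hlim : Tendsto (fun T : ℝ => 2 * C * √(2 * T) * (volume.real F / T)) atTop (nhds 0) := by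
    have h1 : Tendsto (fun T : ℝ => (2 * C * √2 * volume.real F) * (√T)⁻¹) atTop (nhds 0) := by
      simpa using Real.tendsto_sqrt_atTop.inv_tendsto_atTop.const_mul
        (2 * C * √2 * volume.real F)
    refine h1.congr' ?_
    filter_upwards [eventually_gt_atTop 0] with T hT
    have h2 : √T * √T = T := Real.mul_self_sqrt hT.le
    have h3 : 0 < √T := Real.sqrt_pos.2 hT
    rw [Real.sqrt_mul (by norm_num : (0 : ℝ) ≤ 2)]
    nth_rewrite 3 [← h2]
    field_simp
  rw [frequently_atTop]
  intro R0
  obtain ⟨T, ⟨hT1, hT2⟩, hT3⟩ := ((hlim.eventually (gt_mem_nhds hε)).and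
    (eventually_gt_atTop 0) |>.and (eventually_ge_atTop (R0 ^ 2))).exists
  obtain ⟨t, ht, h1, h2⟩ := perim_trunc hF hFv hP hC hT2
  refine ⟨√t, ?_, h1, by linarith⟩
  exact Real.le_sqrt_of_sq_le (by linarith)

lemma real_core {n : ℕ} (hn : 0 < n) {s ν : ℝ} (hs0 : 0 < s) (hs1 : s < 1) (hν : 0 < ν)
    {x y lam : ℕ → ℝ} (hx : ∀ k, 0 < x k) (hxy : ∀ k, y k ≤ ν * x k ^ s)
    (hl0 : ∀ k, 0 < lam k) (hl : Tendsto lam atTop atTop)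
    (hS : ∀ ν' < ν, ∃ p g : ℝ, 0 < p ∧ ν' * p ^ s < g ∧ ∀ (k N : ℕ), 0 < N →
      x k - y k ≤ ((N : ℝ) ^ ((1 : ℝ) / n) / lam k) * p - ((N : ℝ) ^ ((1 : ℝ) / n) / lam k) ^ s * g) :
    Tendsto (fun k => y k / x k ^ s) atTop (nhds ν) ∧ ∃ C : ℝ, 0 < C ∧ ∀ᶠ k in atTop, C ≤ x k := by
  set t0 : ℝ := (ν * s) ^ (1 / (1 - s)) with ht0
  have ht0p : 0 < t0 := by positivity
  have hs1' : 0 < 1 - s := by linarith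
  have hopt : ν * t0 ^ s = t0 / s := by
    have h1 : t0 ^ (1 - s) = ν * s := by
      rw [ht0, ← Real.rpow_mul (by positivity), one_div_mul_cancel hs1'.ne', Real.rpow_one]
    rw [eq_div_iff hs0.ne']
    calc ν * t0 ^ s * s = (ν * s) * t0 ^ s := by ring
      _ = t0 ^ (1 - s) * t0 ^ s := by rw [h1]
      _ = t0 := by rw [← Real.rpow_add ht0p]; simp
  set c : ℝ := t0 / s - t0 with hc
  have hc0 : 0 < c := by
    rw [hc, sub_pos, lt_div_iff₀ hs0]; nlinarith
  have htan : ∀ k, ν * x k ^ s ≤ x k + c := by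
    intro k
    have h1 := rpow_one_add_le_one_add_mul_self (s := x k / t0 - 1) (p := s)
      (by have := hx k; have : 0 < x k / t0 := by positivity
          linarith) hs0.le hs1.le
    rw [add_sub_cancel, Real.div_rpow (hx k).le ht0p.le, div_le_iff₀ (by positivity)] at h1
    calc ν * x k ^ s ≤ ν * ((1 + s * (x k / t0 - 1)) * t0 ^ s) := by gcongr
      _ = (1 + s * (x k / t0 - 1)) * (ν * t0 ^ s) := by ring
      _ = x k + c := by rw [hopt, hc]; field_simp; ring
  have hmain : ∀ η > 0, ∀ᶠ k in atTop, x k + c - η ≤ y k := by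
    intro η hη
    have hts : 0 < t0 ^ s := by positivity
    obtain ⟨p, g, hp, hg, hcomp⟩ := hS (ν - η / t0 ^ s) (by
      have : 0 < η / t0 ^ s := by positivity
      linarith)
    set q : ℝ := t0 / p with hq
    have hq0 : 0 < q := by positivity
    have hln : Tendsto (fun k => lam k ^ n) atTop atTop := (tendsto_pow_atTop hn.ne').comp hl
    have hq1 : Tendsto (fun k => ((⌈q ^ n * lam k ^ n⌉₊ : ℝ) ^ ((1 : ℝ) / n) / lam k)) atTop
        (nhds q) := by
      have h1 := (tendsto_nat_ceil_mul_div_atTop (R := ℝ) (a := q ^ n) (by positivity)).comp hln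
      have h2 := h1.rpow_const (p := (1 : ℝ) / n) (Or.inr (by positivity))
      have h3 : (q ^ n) ^ ((1 : ℝ) / n) = q := by
        rw [one_div, Real.pow_rpow_inv_natCast hq0.le hn.ne']
      rw [h3] at h2
      refine h2.congr fun k => ?_
      have := hl0 k
      simp only [Function.comp]
      rw [Real.div_rpow (by positivity) (by positivity)]
      congr 1
      rw [one_div, Real.pow_rpow_inv_natCast this.le hn.ne']
    have hq2 : Tendsto (fun k => ((⌈q ^ n * lam k ^ n⌉₊ : ℝ) ^ ((1 : ℝ) / n) / lam k) * p -
        ((⌈q ^ n * lam k ^ n⌉₊ : ℝ) ^ ((1 : ℝ) / n) / lam k) ^ s * g) atTop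
        (nhds (q * p - q ^ s * g)) :=
      (hq1.mul_const p).sub ((hq1.rpow_const (Or.inr hs0.le)).mul_const g)
    have hlt : q * p - q ^ s * g < -c + η := by
      have h1 : q * p = t0 := by rw [hq]; field_simp
      have h2 : q ^ s * p ^ s = t0 ^ s := by rw [← Real.mul_rpow hq0.le hp.le, h1]
      have h3 : q ^ s * ((ν - η / t0 ^ s) * p ^ s) < q ^ s * g := by gcongr
      have h4 : q ^ s * ((ν - η / t0 ^ s) * p ^ s) = t0 / s - η := by
        rw [← hopt]
        calc _ = (ν - η / t0 ^ s) * (q ^ s * p ^ s) := by ring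
          _ = _ := by rw [h2]; field_simp
      rw [h1, hc]; linarith
    filter_upwards [hq2.eventually (gt_mem_nhds hlt)] with k hk
    have := hl0 k
    have := hcomp k ⌈q ^ n * lam k ^ n⌉₊ (Nat.ceil_pos.2 (by positivity))
    linarith
  have hlow : ∀ᶠ k in atTop, c / (2 * ν) ≤ x k ^ s := by
    filter_upwards [hmain (c / 2) (by positivity)] with k hk
    have := hxy k
    have := hx k
    rw [div_le_iff₀ (by positivity)]
    linarith
  constructor
  · rw [Metric.tendsto_nhds]
    intro ε hε
    filter_upwards [hlow, hmain (ε * (c / (2 * ν)) / 2) (by positivity)] with k h1 h2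
    have h3 := htan k
    have h4 := hxy k
    have h5 : 0 < x k ^ s := Real.rpow_pos_of_pos (hx k) _
    have h6 : ν - ε / 2 ≤ y k / x k ^ s := by
      rw [le_div_iff₀ h5]
      have : ε * (c / (2 * ν)) ≤ ε * x k ^ s := by gcongr
      linarith
    have h7 : y k / x k ^ s ≤ ν := by rwa [div_le_iff₀ h5]
    rw [Real.dist_eq, abs_lt]
    constructor <;> linarith
  · refine ⟨(c / (2 * ν)) ^ (1 / s), by positivity, ?_⟩
    filter_upwards [hlow] with k hk
    calc _ ≤ (x k ^ s) ^ (1 / s) := by gcongr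
      _ = x k := by
        rw [← Real.rpow_mul (hx k).le, mul_one_div_cancel hs0.ne', Real.rpow_one]

lemma vol_normalize {n : ℕ} (hn : 0 < n) {v : ℝ} (hv : 0 < v) {E : Set (Euc n)}
    (hE : volume E = ENNReal.ofReal v) :
    volume ((v ^ (-(1 : ℝ) / n) : ℝ) • E) = ENNReal.ofReal 1 := by
  rw [vol_smul (by positivity), hE, ← ENNReal.ofReal_mul (by positivity), ← Real.rpow_natCast,
    ← Real.rpow_mul hv.le]
  congr 1
  have : (n : ℝ) ≠ 0 := by positivity
  rw [div_mul_cancel₀ _ this, Real.rpow_neg_one, inv_mul_cancel₀ hv.ne']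

/-- All unit-volume sets satisfy the interpolation inequality. -/
def Interp (n : ℕ) (s μ : ℝ) : Prop := ∀ E : Set (Euc n), MeasurableSet E → HasFinitePerim E →
  volume E = ENNReal.ofReal 1 → μ⁻¹ ≤ perim E ^ s / (s * (1 - s) * Ps n s E)

lemma interp_facts {n : ℕ} {s μ : ℝ} (hs : s ∈ Ioo (0 : ℝ) 1) (hμ : 0 < μ) (h : Interp n s μ)
    {E : Set (Euc n)} (h1 : MeasurableSet E) (h2 : HasFinitePerim E)
    (h3 : volume E = ENNReal.ofReal 1) :
    0 < perim E ∧ 0 < Ps n s E ∧ s * (1 - s) * Ps n s E ≤ μ * perim E ^ s := by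
  have h4 := h E h1 h2 h3
  have hs1 : 0 < 1 - s := by linarith [hs.2]
  have hs0 := hs.1
  have hμi : 0 < μ⁻¹ := inv_pos.2 hμ
  have hp : 0 < perim E := by
    refine lt_of_le_of_ne (perim_nonneg E) fun h0 => ?_
    rw [← h0, Real.zero_rpow hs.1.ne', zero_div] at h4
    linarith
  have hP : 0 < Ps n s E := by
    refine lt_of_le_of_ne (Ps_nonneg n s E) fun h0 => ?_
    rw [← h0, mul_zero, div_zero] at h4
    linarith
  refine ⟨hp, hP, ?_⟩
  rw [le_div_iff₀ (by positivity), inv_mul_le_iff₀ hμ] at h4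
  exact h4

lemma interp_pos {n : ℕ} (hn : 0 < n) {s μ : ℝ} (hs : s ∈ Ioo (0 : ℝ) 1) (hμ : 0 < μ)
    (h : Interp n s μ) {v : ℝ} (hv : 0 < v) {E : Set (Euc n)} (h1 : MeasurableSet E)
    (h2 : HasFinitePerim E) (h3 : volume E = ENNReal.ofReal v) : 0 < Ps n s E := by
  have hc : 0 < v ^ (-(1 : ℝ) / n) := by positivity
  have := (interp_facts hs hμ h (h1.const_smul₀ _) (perim_smul_le hc h2).1
    (vol_normalize hn hv h3)).2.1
  rw [Ps_smul hc] at this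
  exact pos_of_mul_pos_right this (by positivity)

lemma copies {n : ℕ} (hn : 0 < n) {s μ : ℝ} (hs : s ∈ Ioo (0 : ℝ) 1) (hμ : 0 < μ)
    (h : Interp n s μ) {A : Set (Euc n)} (h1 : MeasurableSet A) (h2 : HasFinitePerim A)
    (h3 : volume A = ENNReal.ofReal 1) (bA : Bornology.IsBounded A) (N : ℕ) :
    ∀ δ > 0, ∃ U : Set (Euc n), MeasurableSet U ∧ HasFinitePerim U ∧ Bornology.IsBounded U ∧
      volume U = ENNReal.ofReal ((N : ℝ) + 1) ∧ perim U ≤ ((N : ℝ) + 1) * perim A ∧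
      ((N : ℝ) + 1) * Ps n s A - δ ≤ Ps n s U := by
  induction N with
  | zero =>
    intro δ hδ
    exact ⟨A, h1, h2, bA, by simpa using h3, by simp, by simp; linarith⟩
  | succ N ih =>
    intro δ hδ
    obtain ⟨U, u1, u2, u3, u4, u5, u6⟩ := ih (δ / 2) (by positivity)
    have hpU := interp_pos hn hs hμ h (by positivity) u1 u2 u4
    have hpA := (interp_facts hs hμ h h1 h2 h3).2.1
    obtain ⟨a, hd, hPs⟩ := Ps_union hn hs.1 u1 h1 u3 bA hpU hpA (half_pos hδ)
    have ha := perim_vadd_le a h2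
    have hm : MeasurableSet (a +ᵥ A) := h1.const_vadd a
    have hu := perim_union_le hm hd u2 ha.1
    have hvol : volume (U ∪ (a +ᵥ A)) = ENNReal.ofReal ((N : ℝ) + 1 + 1) := by
      rw [measure_union hd hm, u4, measure_vadd, h3, ← ENNReal.ofReal_add (by positivity) (by simp)]
    refine ⟨U ∪ (a +ᵥ A), u1.union hm, hu.1, u3.union (bA.vadd a), ?_, ?_, ?_⟩
    · push_cast; exact hvol
    · push_cast; linarith [hu.2, ha.2]
    · have := hPs (interp_pos hn hs hμ h (by positivity) (u1.union hm) hu.1 hvol)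
      push_cast; linarith

lemma near_opt {n : ℕ} (hn : 0 < n) {s μ : ℝ} (hs : s ∈ Ioo (0 : ℝ) 1) (hμ : 0 < μ)
    (h : Interp n s μ) {F : Set (Euc n)} (h1 : MeasurableSet F) (h2 : HasFinitePerim F)
    (h3 : volume F = ENNReal.ofReal 1) {a : ℝ} (ha : perim F ^ s / (s * (1 - s) * Ps n s F) < a) :
    ∃ A : Set (Euc n), MeasurableSet A ∧ HasFinitePerim A ∧ volume A = ENNReal.ofReal 1 ∧
      Bornology.IsBounded A ∧ perim A ^ s / (s * (1 - s) * Ps n s A) < a := by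
  obtain ⟨hp, hP, -⟩ := interp_facts hs hμ h h1 h2 h3
  have hs0 := hs.1
  have hs1 : 0 < 1 - s := by linarith [hs.2]
  have hFf : volume F ≠ ∞ := by rw [h3]; exact ENNReal.ofReal_ne_top
  set ψ : ℝ × ℝ → ℝ := fun z => (z.1 ^ n * z.1⁻¹ * (perim F + z.2)) ^ s /
    (s * (1 - s) * (z.1 ^ n * z.1 ^ (-s) * (Ps n s F - z.2))) with hψ
  have hψc : ContinuousAt ψ (1, 0) := by
    have e1 : ContinuousAt (fun z : ℝ × ℝ => z.1⁻¹) (1, 0) :=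
      continuousAt_fst.inv₀ (by norm_num)
    have e2 : ContinuousAt (fun z : ℝ × ℝ => z.1 ^ (-s)) (1, 0) :=
      continuousAt_fst.rpow_const (Or.inl (by norm_num))
    refine ContinuousAt.div ?_ ?_ ?_
    · refine ContinuousAt.rpow_const ?_ (Or.inr hs0.le)
      fun_prop
    · fun_prop
    · simp; refine ⟨⟨hs0.ne', hs1.ne'⟩, hP.ne'⟩
  have hψ0 : ψ (1, 0) < a := by simpa [hψ] using ha
  obtain ⟨ε, hε, hball⟩ := Metric.eventually_nhds_iff.1 (hψc.eventually (gt_mem_nhds hψ0))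
  set δ := min (ε / 2) (Ps n s F / 2) with hδ
  have hδ0 : 0 < δ := by positivity
  have hδε : δ < ε := lt_of_le_of_lt (min_le_left _ _) (by linarith)
  have hδP : δ < Ps n s F := lt_of_le_of_lt (min_le_right _ _) (by linarith)
  set v : ℝ → ℝ := fun R => volume.real (F ∩ closedBall 0 R) with hv
  have hvol : ∀ R, volume (F ∩ closedBall 0 R) = ENNReal.ofReal (v R) := fun R => by
    simp only [hv, measureReal_def]
    rw [ENNReal.ofReal_toReal (measure_ne_top_of_subset inter_subset_left hFf)]
  have hvlim : Tendsto v atTop (nhds 1) := by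
    have hmono : Monotone (fun R : ℝ => F ∩ closedBall (0 : Euc n) R) := fun a b hab =>
      inter_subset_inter_right _ (closedBall_subset_closedBall hab)
    have hU : ⋃ R : ℝ, F ∩ closedBall (0 : Euc n) R = F := by
      ext x
      simp only [mem_iUnion, mem_inter_iff, mem_closedBall]
      exact ⟨fun ⟨R, hR⟩ => hR.1, fun hx => ⟨dist x 0, hx, le_rfl⟩⟩
    have h5 := tendsto_measure_iUnion_atTop (μ := volume) hmono
    rw [hU, h3] at h5
    have h6 := (ENNReal.tendsto_toReal ENNReal.ofReal_ne_top).comp h5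
    rw [ENNReal.toReal_ofReal zero_le_one] at h6
    exact h6
  have hlam : Tendsto (fun R => v R ^ (-(1 : ℝ) / n)) atTop (nhds 1) := by
    have := hvlim.rpow_const (p := -(1 : ℝ) / n) (Or.inl one_ne_zero)
    simpa using this
  have hev := (Ps_trunc hs0 h1 hFf hP hδ0).and ((hvlim.eventually (lt_mem_nhds one_pos)).and
    (Metric.tendsto_nhds.1 hlam ε hε))
  obtain ⟨R, ⟨hR1, hR2⟩, hR3, hR4, hR5⟩ := ((perim_trunc' h1 hFf h2 hδ0).and_eventually hev).exists
  set lam := v R ^ (-(1 : ℝ) / n) with hl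
  have hl0 : 0 < lam := by positivity
  have hm : MeasurableSet (F ∩ closedBall 0 R) := h1.inter measurableSet_closedBall
  have hpos := interp_pos hn hs hμ h hR4 hm hR1 (hvol R)
  have hR6 := hR3 hpos
  refine ⟨lam • (F ∩ closedBall 0 R), hm.const_smul₀ _, (perim_smul_le hl0 hR1).1,
    vol_normalize hn hR4 (hvol R), (isBounded_closedBall.subset inter_subset_right).smul₀ lam, ?_⟩
  have hfin : ψ (lam, δ) < a := hball (by
    rw [Prod.dist_eq, max_lt_iff]
    refine ⟨hR5, ?_⟩
    simp only [dist_zero_right, Real.norm_eq_abs, abs_of_pos hδ0]; exact hδε)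
  refine lt_of_le_of_lt ?_ hfin
  rw [perim_smul hl0 hR1, Ps_smul hl0]
  simp only [hψ]
  have hq := perim_nonneg (F ∩ closedBall 0 R)
  have : 0 < Ps n s F - δ := by linarith
  gcongr

/-- if bounded minimizers `E_k` of `F_{s,α}` exist along a sequence of masses
`m_k → ∞`, then the rescaled sets `F_k = m_k^{-1/n} E_k` have volume 1, form a minimizing
sequence for the optimal interpolation constant, and their perimeters blow up like `m_k^{1/n}`. -/
theorem stmt_10 (n : ℕ) (hn : 2 ≤ n) (s : ℝ) (hs : s ∈ Set.Ioo (0 : ℝ) 1)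
    (α : ℝ) (hα : 0 < α) (μ : ℝ) (hμ : 0 < μ)
    (hμdef : μ⁻¹ = sInf {r : ℝ | ∃ E : Set (Euc n), MeasurableSet E ∧ HasFinitePerim E ∧
      volume E = ENNReal.ofReal 1 ∧ r = perim E ^ s / (s * (1 - s) * Ps n s E)})
    (m : ℕ → ℝ) (hmpos : ∀ k, 0 < m k) (hm : Filter.Tendsto m Filter.atTop Filter.atTop)
    (E : ℕ → Set (Euc n)) (hEbdd : ∀ k, Bornology.IsBounded (E k))
    (hEmin : ∀ k, IsFMin n s α (m k) (E k)) :
    (∀ k, volume ((m k ^ (-(1 : ℝ) / n) : ℝ) • E k) = ENNReal.ofReal 1) ∧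
      Filter.Tendsto
        (fun k => perim ((m k ^ (-(1 : ℝ) / n) : ℝ) • E k) ^ s /
          (s * (1 - s) * Ps n s ((m k ^ (-(1 : ℝ) / n) : ℝ) • E k)))
        Filter.atTop (nhds μ⁻¹) ∧
      (∃ C : ℝ, 0 < C ∧
        ∀ k, C * m k ^ ((1 : ℝ) / n) ≤ perim ((m k ^ (-(1 : ℝ) / n) : ℝ) • E k)) ∧
      Filter.Tendsto (fun k => perim ((m k ^ (-(1 : ℝ) / n) : ℝ) • E k))
        Filter.atTop Filter.atTop := by
  have hn0 : 0 < n := by omega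
  have hnR : (n : ℝ) ≠ 0 := by positivity
  have hs0 := hs.1
  have hs1 : 0 < 1 - s := by linarith [hs.2]
  set SS : Set ℝ := {r : ℝ | ∃ E : Set (Euc n), MeasurableSet E ∧ HasFinitePerim E ∧
      volume E = ENNReal.ofReal 1 ∧ r = perim E ^ s / (s * (1 - s) * Ps n s E)} with hSS
  have hμi : 0 < μ⁻¹ := inv_pos.2 hμ
  have hbdd : BddBelow SS := by
    refine ⟨0, ?_⟩
    rintro r ⟨E, -, -, -, rfl⟩
    have h1 := perim_nonneg E
    have h2 := Ps_nonneg n s E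
    positivity
  have hne : SS.Nonempty := by
    by_contra hc
    rw [not_nonempty_iff_eq_empty] at hc
    rw [hc, Real.sInf_empty] at hμdef
    linarith
  have hI : Interp n s μ := fun A h1 h2 h3 => by
    rw [hμdef]; exact csInf_le hbdd ⟨A, h1, h2, h3, rfl⟩
  have hv1 : ∀ k, volume ((m k ^ (-(1 : ℝ) / n) : ℝ) • E k) = ENNReal.ofReal 1 := fun k =>
    vol_normalize hn0 (hmpos k) (hEmin k).2.2.1
  set lam : ℕ → ℝ := fun k => m k ^ ((1 : ℝ) / n) with hlam
  have hl0 : ∀ k, 0 < lam k := fun k => Real.rpow_pos_of_pos (hmpos k) _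
  have hlt : Tendsto lam atTop atTop := (tendsto_rpow_atTop (by positivity)).comp hm
  have hlinv : ∀ k, m k ^ (-(1 : ℝ) / n) = (lam k)⁻¹ := fun k => by
    rw [hlam, neg_div, Real.rpow_neg (hmpos k).le]
  have hln : ∀ k, lam k ^ n = m k := fun k => by
    simp only [hlam]
    rw [one_div, Real.rpow_inv_natCast_pow (hmpos k).le hn0.ne']
  set x : ℕ → ℝ := fun k => perim (E k) / m k with hx
  set y : ℕ → ℝ := fun k => α * s * (1 - s) * Ps n s (E k) / m k with hy
  have hPk : ∀ k, perim ((m k ^ (-(1 : ℝ) / n) : ℝ) • E k) = lam k * x k := fun k => by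
    have := hl0 k
    rw [hlinv, perim_smul (by positivity) (hEmin k).2.1, inv_pow, hln, inv_inv, hx]
    ring
  have hPsk : ∀ k, α * (s * (1 - s) * Ps n s ((m k ^ (-(1 : ℝ) / n) : ℝ) • E k)) =
      lam k ^ s * y k := fun k => by
    have := hl0 k
    rw [hlinv, Ps_smul (by positivity), inv_pow, hln, Real.inv_rpow this.le,
      Real.rpow_neg this.le, inv_inv, hy]
    ring
  have hfacts := fun k => interp_facts hs hμ hI ((hEmin k).1.const_smul₀ (m k ^ (-(1 : ℝ) / n)))
    (perim_smul_le (Real.rpow_pos_of_pos (hmpos k) _) (hEmin k).2.1).1 (hv1 k)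
  have hx0 : ∀ k, 0 < x k := fun k => by
    have h1 := (hfacts k).1
    rw [hPk] at h1
    exact pos_of_mul_pos_right h1 (hl0 k).le
  have hxy : ∀ k, y k ≤ (α * μ) * x k ^ s := fun k => by
    have h1 := (hfacts k).2.2
    have h2 : α * (s * (1 - s) * Ps n s ((m k ^ (-(1 : ℝ) / n) : ℝ) • E k)) ≤
      α * (μ * perim ((m k ^ (-(1 : ℝ) / n) : ℝ) • E k) ^ s) := by gcongr
    rw [hPsk, hPk, Real.mul_rpow (hl0 k).le (hx0 k).le] at h2
    have h3 : 0 < lam k ^ s := Real.rpow_pos_of_pos (hl0 k) _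
    refine le_of_mul_le_mul_left ?_ h3
    linarith
  have hcore := real_core (n := n) hn0 (ν := α * μ) hs0 hs.2 (by positivity) hx0 hxy hl0 hlt (by
    intro ν' hν'
    set ν2 := max ν' (α * μ / 2) with hν2
    have hαμ : 0 < α * μ := by positivity
    have hν2p : 0 < ν2 := lt_of_lt_of_le (half_pos hαμ) (le_max_right _ _)
    have hν2l : ν2 < α * μ := max_lt hν' (by linarith)
    have hlt2 : sInf SS < α / ν2 := by
      rw [← hμdef, lt_div_iff₀ hν2p, inv_mul_lt_iff₀ hμ]
      linarith
    obtain ⟨r, ⟨F, f1, f2, f3, rfl⟩, hr⟩ := exists_lt_of_csInf_lt hne hlt2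
    obtain ⟨A, a1, a2, a3, a4, a5⟩ := near_opt hn0 hs hμ hI f1 f2 f3 hr
    obtain ⟨ap, aP, -⟩ := interp_facts hs hμ hI a1 a2 a3
    refine ⟨perim A, α * (s * (1 - s) * Ps n s A), ap, ?_, ?_⟩
    · rw [div_lt_div_iff₀ (by positivity) hν2p] at a5
      have : ν' * perim A ^ s ≤ ν2 * perim A ^ s := by
        gcongr; exact le_max_left _ _
      linarith
    · intro k N hN
      obtain ⟨M, rfl⟩ : ∃ M, N = M + 1 := ⟨N - 1, by omega⟩
      set NN : ℝ := (M : ℝ) + 1 with hNN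
      have hcast : ((M + 1 : ℕ) : ℝ) = NN := by push_cast; rfl
      rw [hcast]
      have hNNp : 0 < NN := by positivity
      set q : ℝ := NN ^ ((1 : ℝ) / n) / lam k with hq
      have hlk := hl0 k
      have hmk := hmpos k
      have hq0 : 0 < q := by positivity
      have hqn : q ^ n = NN / m k := by
        rw [hq, div_pow, hln, one_div, Real.rpow_inv_natCast_pow hNNp.le hn0.ne']
      have hK : 0 < α * s * (1 - s) * q ^ s / NN := by positivity
      refine le_of_forall_pos_le_add fun e he => ?_
      obtain ⟨U, u1, u2, u3, u4, u5, u6⟩ := copies hn0 hs hμ hI a1 a2 a3 a4 M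
        (e / (α * s * (1 - s) * q ^ s / NN)) (by positivity)
      have hci : 0 < q⁻¹ := by positivity
      have hcn : q⁻¹ ^ n = m k / NN := by rw [inv_pow, hqn, inv_div]
      have hvol : volume (q⁻¹ • U) = ENNReal.ofReal (m k) := by
        rw [vol_smul hci, u4, hcn, ← ENNReal.ofReal_mul (by positivity)]
        congr 1
        rw [← hNN]
        field_simp
      have hmin := (hEmin k).2.2.2 (q⁻¹ • U) (u1.const_smul₀ _) (perim_smul_le hci u2).1 hvol
      unfold Fen at hmin
      rw [perim_smul hci u2, Ps_smul hci, hcn, inv_inv, Real.inv_rpow hq0.le,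
        Real.rpow_neg hq0.le, inv_inv] at hmin
      have hxyk : x k - y k = (perim (E k) - α * s * (1 - s) * Ps n s (E k)) / m k := by
        simp only [hx, hy]; ring
      rw [hxyk, div_le_iff₀ hmk]
      refine hmin.trans ?_
      have e1 : m k / NN * q * perim U ≤ m k / NN * q * (NN * perim A) := by gcongr
      have e2 : α * s * (1 - s) * (m k / NN * q ^ s *
          (NN * Ps n s A - e / (α * s * (1 - s) * q ^ s / NN))) ≤
          α * s * (1 - s) * (m k / NN * q ^ s * Ps n s U) := by gcongr
      have e3 : m k / NN * q * (NN * perim A) - α * s * (1 - s) * (m k / NN * q ^ s *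
          (NN * Ps n s A - e / (α * s * (1 - s) * q ^ s / NN))) =
          (q * perim A - q ^ s * (α * (s * (1 - s) * Ps n s A)) + e) * m k := by
        have hqs : 0 < q ^ s := by positivity
        have hs1' := hs1.ne'
        field_simp
        ring
      linarith)
  obtain ⟨hc1, C0, hC0, hc2⟩ := hcore
  have hC : ∃ C : ℝ, 0 < C ∧ ∀ k, C ≤ x k := by
    obtain ⟨K, hK⟩ := eventually_atTop.1 hc2
    obtain ⟨i, -, hi⟩ := Finset.exists_min_image (Finset.range (K + 1)) x ⟨0, by simp⟩
    refine ⟨min C0 (x i), lt_min hC0 (hx0 i), fun k => ?_⟩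
    by_cases hk : K ≤ k
    · exact (min_le_left _ _).trans (hK k hk)
    · exact (min_le_right _ _).trans (hi k (by simp; omega))
  obtain ⟨C, hCp, hCk⟩ := hC
  have hbound : ∀ k, C * m k ^ ((1 : ℝ) / n) ≤ perim ((m k ^ (-(1 : ℝ) / n) : ℝ) • E k) := by
    intro k
    rw [hPk, mul_comm]
    exact mul_le_mul_of_nonneg_left (hCk k) (hl0 k).le
  refine ⟨hv1, ?_, ⟨C, hCp, hbound⟩, ?_⟩
  · have h1 := (hc1.inv₀ (by positivity)).const_mul α
    have h2 : α * (α * μ)⁻¹ = μ⁻¹ := by field_simp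
    rw [h2] at h1
    refine h1.congr fun k => ?_
    have h3 := hPsk k
    have h4 : s * (1 - s) * Ps n s ((m k ^ (-(1 : ℝ) / n) : ℝ) • E k) = lam k ^ s * y k / α := by
      rw [eq_div_iff hα.ne', ← h3]; ring
    have h5 : 0 < lam k ^ s := Real.rpow_pos_of_pos (hl0 k) _
    rw [h4, hPk, Real.mul_rpow (hl0 k).le (hx0 k).le]
    generalize y k = Y
    generalize x k ^ s = X
    generalize lam k ^ s = Z at *
    rw [inv_div]
    field_simp
  · exact tendsto_atTop_mono hbound (hlt.const_mul_atTop hCp)
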